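/- (Sufficiency of local testing for the weak-type bound.) Let 1 < p ≤ q < ∞, let τ = (τ_Q)_{Q∈𝒬} be nonnegative constants, and let σ, ω be weights on ℝ^d. Suppose the local testing constant 𝔏 = ⟦σ,ω⟧^Loc_{τ,p,q} is finite. Then for every nonnegative f ∈ L^p(σ) and every λ > 0, λ^q · ω({x : T_τ(fσ)(x) > λ}) ≤ C(p,q,d) · 𝔏^q · ‖f‖_{L^p(σ)}^q. -/

import Mathlib

open MeasureTheory ENNReal

noncomputable section

/-- Index set for dyadic cubes of `ℝ^d`: a scale `k : ℤ` and a position `n ∈ ℤ^d`. -/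
abbrev DIdx (d : ℕ) : Type := ℤ × (Fin d → ℤ)

/-- The dyadic cube `∏_j [2^k n_j, 2^k (n_j + 1))` of `ℝ^d`. -/
def dcube {d : ℕ} (i : DIdx d) : Set (Fin d → ℝ) :=
  {x | ∀ j, x j ∈ Set.Ico ((2 : ℝ) ^ i.1 * (i.2 j : ℝ)) ((2 : ℝ) ^ i.1 * ((i.2 j : ℝ) + 1))}

/-- The dyadic parent of a dyadic cube: the minimal dyadic cube strictly containing it. -/
def dparent {d : ℕ} (i : DIdx d) : DIdx d :=
  (i.1 + 1, fun j => Int.fdiv (i.2 j) 2)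

/-- The measure `ω dx` on `ℝ^d` associated with a weight `ω`. -/
def wMeasure {d : ℕ} (ω : (Fin d → ℝ) → ℝ≥0∞) : Measure (Fin d → ℝ) :=
  volume.withDensity ω

/-- The average of a nonnegative function `f` over the dyadic cube indexed by `i`,
with respect to the measure `μ`. -/
def cavg {d : ℕ} (μ : Measure (Fin d → ℝ)) (i : DIdx d) (f : (Fin d → ℝ) → ℝ≥0∞) : ℝ≥0∞ :=
  (∫⁻ x in dcube i, f x ∂μ) / μ (dcube i)

/-- Lebesgue average of a nonnegative function over a dyadic cube. -/
def lavg {d : ℕ} (i : DIdx d) (f : (Fin d → ℝ) → ℝ≥0∞) : ℝ≥0∞ :=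
  cavg volume i f

/-- The `L^p` norm (real exponent `p`) of a nonnegative function with respect to `μ`. -/
def lpn {d : ℕ} (p : ℝ) (μ : Measure (Fin d → ℝ)) (f : (Fin d → ℝ) → ℝ≥0∞) : ℝ≥0∞ :=
  (∫⁻ x, f x ^ p ∂μ) ^ (1 / p)

/-- The positive dyadic operator `T_τ f = ∑_Q τ_Q (E_Q f) 1_Q`. -/
def Tdy {d : ℕ} (τ : DIdx d → ℝ≥0∞) (f : (Fin d → ℝ) → ℝ≥0∞) (x : Fin d → ℝ) : ℝ≥0∞ :=
  ∑' i : DIdx d, (dcube i).indicator (fun _ => τ i * lavg i f) x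

/-- The local part `T^in_{τ,R} f = ∑_{Q ⊆ R} τ_Q (E_Q f) 1_Q`. -/
def TdyIn {d : ℕ} (τ : DIdx d → ℝ≥0∞) (R : DIdx d) (f : (Fin d → ℝ) → ℝ≥0∞)
    (x : Fin d → ℝ) : ℝ≥0∞ :=
  ∑' i : {i : DIdx d // dcube i ⊆ dcube R},
    (dcube i.1).indicator (fun _ => τ i.1 * lavg i.1 f) x

/-- The global part `T^out_{τ,R} f = ∑_{Q ⊇ R} τ_Q (E_Q f) 1_Q`. -/
def TdyOut {d : ℕ} (τ : DIdx d → ℝ≥0∞) (R : DIdx d) (f : (Fin d → ℝ) → ℝ≥0∞)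
    (x : Fin d → ℝ) : ℝ≥0∞ :=
  ∑' i : {i : DIdx d // dcube R ⊆ dcube i},
    (dcube i.1).indicator (fun _ => τ i.1 * lavg i.1 f) x

/-- The local testing constant `⟦σ,ω⟧^Loc_{τ,p,q}
= sup_{R : ω(R)>0} ω(R)^{-1/q'} ‖T^in_{τ,R}(1_R ω)‖_{L^{p'}(σ)}`. -/
def locTest {d : ℕ} (p q : ℝ) (τ : DIdx d → ℝ≥0∞) (σ ω : (Fin d → ℝ) → ℝ≥0∞) : ℝ≥0∞ :=
  ⨆ (R : DIdx d) (_ : wMeasure ω (dcube R) ≠ 0),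
    wMeasure ω (dcube R) ^ (-(1 / (q / (q - 1)))) *
      lpn (p / (p - 1)) (wMeasure σ) (TdyIn τ R ((dcube R).indicator ω))

/-- The global testing constant `⟦σ,ω⟧^Glo_{τ,p,q}
= sup_{R : ω(R)>0} ω(R)^{-1/q'} ‖T^out_{τ,R}(1_R ω)‖_{L^{p'}(σ)}`. -/
def gloTest {d : ℕ} (p q : ℝ) (τ : DIdx d → ℝ≥0∞) (σ ω : (Fin d → ℝ) → ℝ≥0∞) : ℝ≥0∞ :=
  ⨆ (R : DIdx d) (_ : wMeasure ω (dcube R) ≠ 0),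
    wMeasure ω (dcube R) ^ (-(1 / (q / (q - 1)))) *
      lpn (p / (p - 1)) (wMeasure σ) (TdyOut τ R ((dcube R).indicator ω))

/-- The least weak-type `L^p(σ) → L^{q,∞}(ω)` constant of `f ↦ T_τ(fσ)`. -/
def weakConst {d : ℕ} (p q : ℝ) (τ : DIdx d → ℝ≥0∞) (σ ω : (Fin d → ℝ) → ℝ≥0∞) : ℝ≥0∞ :=
  sInf {N : ℝ≥0∞ | ∀ f : (Fin d → ℝ) → ℝ≥0∞, Measurable f → lpn p (wMeasure σ) f ≠ ⊤ →
    ∀ lam : ℝ≥0∞, 0 < lam →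
      wMeasure ω {x | lam < Tdy τ (fun y => f y * σ y) x} ≤
        (N * lpn p (wMeasure σ) f / lam) ^ q}


theorem measurableSet_dcube {d : ℕ} (i : DIdx d) : MeasurableSet (dcube i) := by
  have : dcube i = Set.univ.pi fun j =>
      Set.Ico ((2 : ℝ) ^ i.1 * (i.2 j : ℝ)) ((2 : ℝ) ^ i.1 * ((i.2 j : ℝ) + 1)) := by
    ext x; simp [dcube]
  rw [this]
  exact MeasurableSet.univ_pi fun _ => measurableSet_Ico

/-- Positions of two dyadic cubes with a common point. -/
theorem exists_pow_of_mem_dcube {d : ℕ} {i j : DIdx d} {x : Fin d → ℝ} (hi : x ∈ dcube i)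
    (hj : x ∈ dcube j) (hij : i.1 ≤ j.1) :
    ∃ m : ℕ, j.1 = i.1 + m ∧
      ∀ l, 2 ^ m * j.2 l ≤ i.2 l ∧ i.2 l + 1 ≤ 2 ^ m * (j.2 l + 1) := by
  obtain ⟨m, hm⟩ := Int.le.dest hij
  refine ⟨m, hm.symm, fun l => ?_⟩
  have h1 := hi l
  have h2 := hj l
  rw [← hm, zpow_add₀ two_ne_zero, zpow_natCast, mul_assoc, mul_assoc] at h2
  have h0 : (0 : ℝ) < 2 ^ i.1 := by positivity
  constructor
  · have h := lt_of_mul_lt_mul_left (h2.1.trans_lt h1.2) h0.le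
    exact Int.lt_add_one_iff.1 (by exact_mod_cast h)
  · have h := lt_of_mul_lt_mul_left (h1.1.trans_lt h2.2) h0.le
    exact Int.add_one_le_iff.2 (by exact_mod_cast h)

theorem dcube_subset_of_mem {d : ℕ} {i j : DIdx d} {x : Fin d → ℝ} (hi : x ∈ dcube i)
    (hj : x ∈ dcube j) (hij : i.1 ≤ j.1) : dcube i ⊆ dcube j := by
  obtain ⟨m, hm, h⟩ := exists_pow_of_mem_dcube hi hj hij
  intro y hy l
  have h0 : (0 : ℝ) < 2 ^ i.1 := by positivity
  have h1 : (2 : ℝ) ^ m * j.2 l ≤ i.2 l := by exact_mod_cast (h l).1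
  have h2 : (i.2 l : ℝ) + 1 ≤ 2 ^ m * (j.2 l + 1) := by exact_mod_cast (h l).2
  rw [hm, zpow_add₀ two_ne_zero, zpow_natCast, mul_assoc, mul_assoc]
  exact ⟨(mul_le_mul_of_nonneg_left h1 h0.le).trans (hy l).1,
    (hy l).2.trans_le (mul_le_mul_of_nonneg_left h2 h0.le)⟩

theorem eq_of_mem_dcube {d : ℕ} {i j : DIdx d} {x : Fin d → ℝ} (hi : x ∈ dcube i)
    (hj : x ∈ dcube j) (hij : i.1 = j.1) : i = j := by
  obtain ⟨m, hm, h⟩ := exists_pow_of_mem_dcube hi hj hij.le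
  obtain rfl : m = 0 := by omega
  refine Prod.ext hij (funext fun l => ?_)
  have := h l
  simp only [pow_zero, one_mul] at this
  omega

/-- The part at scales at least `2 ^ k` of the step function `∑_{i ∈ F} a_i 1_{Q_i}`. -/
def coarseSum {d : ℕ} (F : Finset (DIdx d)) (a : DIdx d → ℝ≥0∞) (k : ℤ) (x : Fin d → ℝ) : ℝ≥0∞ :=
  ∑ j ∈ F, if k ≤ j.1 then (dcube j).indicator (fun _ => a j) x else 0

theorem coarseSum_anti {d : ℕ} (F : Finset (DIdx d)) (a : DIdx d → ℝ≥0∞) {k l : ℤ} (h : k ≤ l)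
    (x : Fin d → ℝ) : coarseSum F a l x ≤ coarseSum F a k x := by
  refine Finset.sum_le_sum fun j _ => ?_
  split_ifs
  · exact le_rfl
  · omega
  · exact zero_le
  · exact le_rfl

theorem coarseSum_le {d : ℕ} (F : Finset (DIdx d)) (a : DIdx d → ℝ≥0∞) (k : ℤ)
    (x : Fin d → ℝ) :
    coarseSum F a k x ≤ ∑ j ∈ F, (dcube j).indicator (fun _ => a j) x := by
  refine Finset.sum_le_sum fun j _ => ?_
  split_ifs
  · exact le_rfl
  · exact zero_le

theorem coarseSum_congr {d : ℕ} (F : Finset (DIdx d)) (a : DIdx d → ℝ≥0∞) {i : DIdx d} {k : ℤ}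
    (hk : i.1 ≤ k) {x y : Fin d → ℝ} (hx : x ∈ dcube i) (hy : y ∈ dcube i) :
    coarseSum F a k x = coarseSum F a k y := by
  refine Finset.sum_congr rfl fun j _ => ?_
  split_ifs with h
  · have : x ∈ dcube j ↔ y ∈ dcube j :=
      ⟨fun h' => dcube_subset_of_mem hx h' (hk.trans h) hy,
        fun h' => dcube_subset_of_mem hy h' (hk.trans h) hx⟩
    by_cases h' : x ∈ dcube j
    · simp [h', this.1 h']
    · rw [Set.indicator_of_notMem h', Set.indicator_of_notMem fun h'' => h' (this.2 h'')]
  · rfl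

theorem exists_lt_coarseSum {d : ℕ} {F : Finset (DIdx d)} {a : DIdx d → ℝ≥0∞} {k : ℤ}
    {x : Fin d → ℝ} {lam : ℝ≥0∞} (h : lam < coarseSum F a k x) :
    ∃ i ∈ F, x ∈ dcube i ∧ k ≤ i.1 ∧ lam < coarseSum F a i.1 x := by
  classical
  have hne : (F.filter fun j => x ∈ dcube j ∧ k ≤ j.1).Nonempty := by
    by_contra hcon
    rw [Finset.not_nonempty_iff_eq_empty, Finset.filter_eq_empty_iff] at hcon
    refine not_lt_bot (h.trans_le (le_of_eq (Finset.sum_eq_zero fun j hj => ?_)))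
    split_ifs with hk
    · exact Set.indicator_of_notMem (fun hx => hcon hj ⟨hx, hk⟩) _
    · rfl
  obtain ⟨i, hi, hmin⟩ := Finset.exists_min_image _ (fun j : DIdx d => j.1) hne
  rw [Finset.mem_filter] at hi
  refine ⟨i, hi.1, hi.2.1, hi.2.2, h.trans_le (Finset.sum_le_sum fun j hj => ?_)⟩
  split_ifs with h1 h2
  · exact le_rfl
  · rw [Set.indicator_of_notMem]
    exact fun hx => h2 (hmin j (Finset.mem_filter.2 ⟨hj, hx, h1⟩))
  · exact zero_le
  · exact le_rfl

/-- The maximal cubes on which the coarse part of `∑_{i ∈ F} a_i 1_{Q_i}` exceeds `lam`. -/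
theorem exists_stopping_cubes {d : ℕ} (F : Finset (DIdx d)) (a : DIdx d → ℝ≥0∞) (lam : ℝ≥0∞) :
    ∃ S : Finset (DIdx d), (S : Set (DIdx d)).PairwiseDisjoint dcube ∧
      (⋃ R ∈ S, dcube R) = {x | lam < ∑ j ∈ F, (dcube j).indicator (fun _ => a j) x} ∧
      ∀ R ∈ S, ∀ x ∈ dcube R, 2 * lam < ∑ j ∈ F, (dcube j).indicator (fun _ => a j) x →
        lam < ∑' j : {j : DIdx d // dcube j ⊆ dcube R},
          (dcube j.1).indicator (fun _ => a j.1) x := by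
  classical
  refine ⟨F.filter fun i => ∃ x ∈ dcube i,
    lam < coarseSum F a i.1 x ∧ coarseSum F a (i.1 + 1) x ≤ lam, ?_, ?_, ?_⟩
  · have key : ∀ {i j : DIdx d} {z : Fin d → ℝ}, z ∈ dcube i → z ∈ dcube j →
        (∃ x ∈ dcube i, coarseSum F a (i.1 + 1) x ≤ lam) →
        (∃ x ∈ dcube j, lam < coarseSum F a j.1 x) → j.1 ≤ i.1 := by
      rintro i j z hzi hzj ⟨x, hx, hx'⟩ ⟨y, hy, hy'⟩
      by_contra! hlt
      rw [coarseSum_congr F a (by omega) hx hzi] at hx'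
      rw [coarseSum_congr F a le_rfl hy hzj] at hy'
      exact absurd (hy'.trans_le ((coarseSum_anti F a (by omega) z).trans hx')) (lt_irrefl _)
    intro i hi j hj hij
    rw [Function.onFun, Set.disjoint_left]
    intro z hzi hzj
    obtain ⟨x, hx, hx1, hx2⟩ := (Finset.mem_filter.1 (Finset.mem_coe.1 hi)).2
    obtain ⟨y, hy, hy1, hy2⟩ := (Finset.mem_filter.1 (Finset.mem_coe.1 hj)).2
    exact hij (eq_of_mem_dcube hzi hzj (le_antisymm (key hzj hzi ⟨y, hy, hy2⟩ ⟨x, hx, hx1⟩)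
      (key hzi hzj ⟨x, hx, hx2⟩ ⟨y, hy, hy1⟩)))
  · ext x
    simp only [Set.mem_iUnion, Finset.mem_filter, Set.mem_ofPred_eq, exists_prop]
    constructor
    · rintro ⟨i, ⟨-, y, hy, hy1, -⟩, hx⟩
      rw [coarseSum_congr F a le_rfl hy hx] at hy1
      exact hy1.trans_le (coarseSum_le F a _ x)
    · intro hx
      obtain ⟨k, hk⟩ : ∃ k : ℤ, ∀ j ∈ F, k ≤ j.1 := by
        obtain ⟨k, hk⟩ := (F.image Prod.fst).bddBelow
        exact ⟨k, fun j hj => hk (Finset.mem_coe.2 (Finset.mem_image_of_mem _ hj))⟩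
      have hk' : lam < coarseSum F a k x := by
        refine hx.trans_le (Finset.sum_le_sum fun j hj => ?_)
        rw [if_pos (hk j hj)]
      have hne : (F.filter fun j => x ∈ dcube j ∧ lam < coarseSum F a j.1 x).Nonempty := by
        obtain ⟨i, hi, hi1, -, hi2⟩ := exists_lt_coarseSum hk'
        exact ⟨i, Finset.mem_filter.2 ⟨hi, hi1, hi2⟩⟩
      obtain ⟨i, hi, hmax⟩ := Finset.exists_max_image _ (fun j : DIdx d => j.1) hne
      rw [Finset.mem_filter] at hi
      refine ⟨i, ⟨hi.1, x, hi.2.1, hi.2.2, ?_⟩, hi.2.1⟩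
      by_contra! hcon
      obtain ⟨j, hj, hj1, hj2, hj3⟩ := exists_lt_coarseSum hcon
      have := hmax j (Finset.mem_filter.2 ⟨hj, hj1, hj3⟩)
      omega
  · intro R hR x hx h2
    obtain ⟨y, hy, -, hy2⟩ := (Finset.mem_filter.1 hR).2
    rw [coarseSum_congr F a (by omega) hy hx] at hy2
    by_contra! hcon
    refine absurd h2 (not_lt.2 ?_)
    rw [two_mul]
    refine le_trans ?_ (add_le_add hy2 hcon)
    have hsub : ∑' j : {j : DIdx d // dcube j ⊆ dcube R},
          (dcube j.1).indicator (fun _ => a j.1) x =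
        ∑' j : DIdx d, if dcube j ⊆ dcube R then (dcube j).indicator (fun _ => a j) x else 0 := by
      rw [← tsum_subtype_eq_of_support_subset (s := {j : DIdx d | dcube j ⊆ dcube R})]
      · exact tsum_congr fun j => (if_pos j.2).symm
      · intro j hj
        by_contra h
        exact hj (if_neg h)
    rw [hsub]
    refine le_trans ?_ (add_le_add_right (ENNReal.sum_le_tsum F) _)
    rw [coarseSum, ← Finset.sum_add_distrib]
    refine Finset.sum_le_sum fun j _ => ?_
    by_cases hj : x ∈ dcube j
    · rcases le_or_gt (R.1 + 1) j.1 with h | h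
      · rw [if_pos h]; exact le_self_add
      · rw [if_pos (dcube_subset_of_mem hj hx (by omega))]; exact le_add_self
    · rw [Set.indicator_of_notMem hj]; exact zero_le

theorem measurable_indicator_dcube {d : ℕ} (i : DIdx d) (c : ℝ≥0∞) :
    Measurable ((dcube i).indicator fun _ => c) :=
  measurable_const.indicator (measurableSet_dcube i)

theorem measurable_TdyIn {d : ℕ} (τ : DIdx d → ℝ≥0∞) (R : DIdx d) (f : (Fin d → ℝ) → ℝ≥0∞) :
    Measurable (TdyIn τ R f) :=
  Measurable.tsum fun i => measurable_indicator_dcube i.1 _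

theorem setLIntegral_weighted {d : ℕ} {σ f : (Fin d → ℝ) → ℝ≥0∞} (hσ : Measurable σ)
    (hf : Measurable f) (i : DIdx d) :
    ∫⁻ x in dcube i, f x * σ x = ∫⁻ x in dcube i, f x ∂wMeasure σ := by
  rw [wMeasure, setLIntegral_withDensity_eq_setLIntegral_mul _ hσ hf (measurableSet_dcube i)]
  simp [mul_comm]

theorem lintegral_mul_indicator_dcube {d : ℕ} {μ : Measure (Fin d → ℝ)}
    {f : (Fin d → ℝ) → ℝ≥0∞} (hf : Measurable f) (i : DIdx d) (c : ℝ≥0∞) :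
    ∫⁻ x, f x * (dcube i).indicator (fun _ => c) x ∂μ = (∫⁻ x in dcube i, f x ∂μ) * c := by
  rw [← lintegral_mul_const _ hf, ← lintegral_indicator (measurableSet_dcube i)]
  refine lintegral_congr fun x => ?_
  by_cases hx : x ∈ dcube i <;> simp [hx]

theorem setLIntegral_indicator_dcube_le {d : ℕ} (t : ℝ≥0∞) {σ ω f : (Fin d → ℝ) → ℝ≥0∞}
    (hσ : Measurable σ) (hf : Measurable f) {i R : DIdx d} (hi : dcube i ⊆ dcube R)
    (E : Set (Fin d → ℝ)) :
    ∫⁻ x in E, (dcube i).indicator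
        (fun _ => t * lavg i (fun y => f y * σ y)) x ∂wMeasure ω ≤
      ∫⁻ x, f x * (dcube i).indicator
        (fun _ => t * lavg i ((dcube R).indicator ω)) x ∂wMeasure σ := by
  have hm := measurableSet_dcube i
  have hcomm : ∀ a b c e : ℝ≥0∞, a * (b * c) * e = b * (a * (e * c)) := by
    intros; ring
  have hω : ∫⁻ x in dcube i, (dcube R).indicator ω x = wMeasure ω (dcube i) := by
    rw [wMeasure, withDensity_apply _ hm]
    exact setLIntegral_congr_fun hm fun x hx => Set.indicator_of_mem (hi hx) _
  rw [lintegral_mul_indicator_dcube hf, lintegral_indicator_const hm, lavg, lavg, cavg, cavg,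
    setLIntegral_weighted hσ hf, hω, div_eq_mul_inv, div_eq_mul_inv, ← hcomm]
  exact mul_le_mul' le_rfl (Measure.restrict_apply_le E _)

/-- Duality between the local operator acting on `fσ` and on `ω`. -/
theorem setLIntegral_TdyIn_le {d : ℕ} (τ : DIdx d → ℝ≥0∞) {σ ω f : (Fin d → ℝ) → ℝ≥0∞}
    (hσ : Measurable σ) (hf : Measurable f) (R : DIdx d) (E : Set (Fin d → ℝ)) :
    ∫⁻ x in E, TdyIn τ R (fun y => f y * σ y) x ∂wMeasure ω ≤
      ∫⁻ x, f x * TdyIn τ R ((dcube R).indicator ω) x ∂wMeasure σ := by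
  have hmeas : ∀ i : {i : DIdx d // dcube i ⊆ dcube R}, AEMeasurable (fun x => f x *
      (dcube i.1).indicator (fun _ => τ i.1 * lavg i.1 ((dcube R).indicator ω)) x)
      (wMeasure σ) :=
    fun i => (Measurable.mul hf (measurable_indicator_dcube i.1 _)).aemeasurable
  calc ∫⁻ x in E, TdyIn τ R (fun y => f y * σ y) x ∂wMeasure ω
      = ∑' i : {i : DIdx d // dcube i ⊆ dcube R}, ∫⁻ x in E, (dcube i.1).indicator
        (fun _ => τ i.1 * lavg i.1 (fun y => f y * σ y)) x ∂wMeasure ω :=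
        lintegral_tsum fun i => (measurable_indicator_dcube i.1 _).aemeasurable
    _ ≤ ∑' i : {i : DIdx d // dcube i ⊆ dcube R}, ∫⁻ x, f x * (dcube i.1).indicator
        (fun _ => τ i.1 * lavg i.1 ((dcube R).indicator ω)) x ∂wMeasure σ :=
        ENNReal.tsum_le_tsum fun i => setLIntegral_indicator_dcube_le _ hσ hf i.2 E
    _ = ∫⁻ x, ∑' i : {i : DIdx d // dcube i ⊆ dcube R}, f x * (dcube i.1).indicator
        (fun _ => τ i.1 * lavg i.1 ((dcube R).indicator ω)) x ∂wMeasure σ :=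
        (lintegral_tsum hmeas).symm
    _ = ∫⁻ x, f x * TdyIn τ R ((dcube R).indicator ω) x ∂wMeasure σ :=
        lintegral_congr fun x => ENNReal.tsum_mul_left

theorem sum_rpow_le_rpow_sum {ι : Type*} (s : Finset ι) (g : ι → ℝ≥0∞) {r : ℝ} (hr : 1 ≤ r) :
    ∑ i ∈ s, g i ^ r ≤ (∑ i ∈ s, g i) ^ r := by
  classical
  induction s using Finset.induction_on with
  | empty => simp
  | insert i s hi ih =>
    rw [Finset.sum_insert hi, Finset.sum_insert hi]
    exact (add_le_add_right ih _).trans (ENNReal.add_rpow_le_rpow_add _ _ hr)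

/-- Local testing on one cube. -/
theorem local_testing_bound {d : ℕ} {p q : ℝ} (hp : 1 < p) (hpq : p ≤ q) (τ : DIdx d → ℝ≥0∞)
    {σ ω f : (Fin d → ℝ) → ℝ≥0∞} (hσ : Measurable σ) (hf : Measurable f) {R : DIdx d}
    (h0 : wMeasure ω (dcube R) ≠ 0) (ht : wMeasure ω (dcube R) ≠ ⊤)
    {E : Set (Fin d → ℝ)} (hE : MeasurableSet E) {lam ε : ℝ≥0∞}
    (hlam : ∀ x ∈ E, lam ≤ TdyIn τ R (fun y => f y * σ y) x)
    (hε : ε * wMeasure ω (dcube R) ≤ wMeasure ω E) :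
    ε ^ q * (lam ^ q * wMeasure ω (dcube R)) ≤
      locTest p q τ σ ω ^ q * (∫⁻ x in dcube R, f x ^ p ∂wMeasure σ) ^ (q / p) := by
  have hp0 : 0 < p := by linarith
  have hq0 : 0 < q := by linarith
  have hpp : p.HolderConjugate (p / (p - 1)) := Real.HolderConjugate.conjExponent hp
  set g := TdyIn τ R ((dcube R).indicator ω) with hg
  have hmR := measurableSet_dcube R
  have h1 : lam * (ε * wMeasure ω (dcube R)) ≤
      (∫⁻ x in dcube R, f x ^ p ∂wMeasure σ) ^ (1 / p) *
        lpn (p / (p - 1)) (wMeasure σ) g := by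
    calc lam * (ε * wMeasure ω (dcube R)) ≤ lam * wMeasure ω E := by gcongr
      _ = ∫⁻ _ in E, lam ∂wMeasure ω := by rw [setLIntegral_const]
      _ ≤ ∫⁻ x in E, TdyIn τ R (fun y => f y * σ y) x ∂wMeasure ω := setLIntegral_mono' hE hlam
      _ ≤ ∫⁻ x, f x * g x ∂wMeasure σ := setLIntegral_TdyIn_le τ hσ hf R E
      _ = ∫⁻ x, ((dcube R).indicator f * g) x ∂wMeasure σ := by
        refine lintegral_congr fun x => ?_
        by_cases hx : x ∈ dcube R
        · simp [hx]
        · have : g x = 0 := by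
            refine ENNReal.tsum_eq_zero.2 fun i => Set.indicator_of_notMem (fun h => hx (i.2 h)) _
          simp [this]
      _ ≤ (∫⁻ x, (dcube R).indicator f x ^ p ∂wMeasure σ) ^ (1 / p) *
          (∫⁻ x, g x ^ (p / (p - 1)) ∂wMeasure σ) ^ (1 / (p / (p - 1))) :=
        ENNReal.lintegral_mul_le_Lp_mul_Lq _ hpp (hf.indicator hmR).aemeasurable
          (measurable_TdyIn _ _ _).aemeasurable
      _ = _ := by
        rw [lpn, ← lintegral_indicator hmR]
        congr 3
        funext x
        by_cases hx : x ∈ dcube R <;> simp [hx, hp0]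
  have h2 : wMeasure ω (dcube R) ^ (-(1 / (q / (q - 1)))) *
      lpn (p / (p - 1)) (wMeasure σ) g ≤ locTest p q τ σ ω :=
    le_iSup₂ (f := fun (R : DIdx d) (_ : wMeasure ω (dcube R) ≠ 0) =>
      wMeasure ω (dcube R) ^ (-(1 / (q / (q - 1)))) *
        lpn (p / (p - 1)) (wMeasure σ) (TdyIn τ R ((dcube R).indicator ω))) R h0
  have hw : wMeasure ω (dcube R) ^ (-(1 / (q / (q - 1)))) * wMeasure ω (dcube R) =
      wMeasure ω (dcube R) ^ (1 / q) := by
    conv_lhs => rw [← ENNReal.rpow_one (wMeasure ω (dcube R)), ← ENNReal.rpow_mul, one_mul]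
    rw [← ENNReal.rpow_add _ _ h0 ht]
    congr 1
    field_simp
    ring
  have h3 : ε * (lam * wMeasure ω (dcube R) ^ (1 / q)) ≤ locTest p q τ σ ω *
      (∫⁻ x in dcube R, f x ^ p ∂wMeasure σ) ^ (1 / p) := by
    calc _ = wMeasure ω (dcube R) ^ (-(1 / (q / (q - 1)))) *
          (lam * (ε * wMeasure ω (dcube R))) := by rw [← hw]; ring
      _ ≤ wMeasure ω (dcube R) ^ (-(1 / (q / (q - 1)))) *
          ((∫⁻ x in dcube R, f x ^ p ∂wMeasure σ) ^ (1 / p) *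
            lpn (p / (p - 1)) (wMeasure σ) g) := by gcongr
      _ = (wMeasure ω (dcube R) ^ (-(1 / (q / (q - 1)))) *
            lpn (p / (p - 1)) (wMeasure σ) g) *
          (∫⁻ x in dcube R, f x ^ p ∂wMeasure σ) ^ (1 / p) := by ring
      _ ≤ _ := by gcongr
  have h4 := ENNReal.rpow_le_rpow h3 hq0.le
  rw [ENNReal.mul_rpow_of_nonneg _ _ hq0.le, ENNReal.mul_rpow_of_nonneg _ _ hq0.le,
    ENNReal.mul_rpow_of_nonneg _ _ hq0.le, ← ENNReal.rpow_mul, ← ENNReal.rpow_mul,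
    one_div_mul_cancel hq0.ne', ENNReal.rpow_one, one_div_mul_eq_div] at h4
  exact h4

theorem measurableSet_lt_sum_indicator {d : ℕ} (F : Finset (DIdx d)) (a : DIdx d → ℝ≥0∞)
    (lam : ℝ≥0∞) :
    MeasurableSet {x | lam < ∑ j ∈ F, (dcube j).indicator (fun _ => a j) x} :=
  measurableSet_lt measurable_const
    (Finset.measurable_sum F fun j _ => measurable_indicator_dcube j _)

/-- Good-`λ` inequality for finite truncations of `T_τ(fσ)`. -/
theorem good_lambda {d : ℕ} {p q : ℝ} (hp : 1 < p) (hpq : p ≤ q) (τ : DIdx d → ℝ≥0∞)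
    {σ ω f : (Fin d → ℝ) → ℝ≥0∞} (hσ : Measurable σ) (hf : Measurable f)
    (hω : ∀ i : DIdx d, wMeasure ω (dcube i) ≠ ⊤) (F : Finset (DIdx d)) (lam : ℝ≥0∞)
    {ε : ℝ≥0∞} (hε0 : ε ≠ 0) (hεt : ε ≠ ⊤) :
    lam ^ q * wMeasure ω {x | 2 * lam < ∑ j ∈ F, (dcube j).indicator
        (fun _ => τ j * lavg j (fun y => f y * σ y)) x} ≤
      ε * (lam ^ q * wMeasure ω {x | lam < ∑ j ∈ F, (dcube j).indicator
        (fun _ => τ j * lavg j (fun y => f y * σ y)) x}) +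
      (ε ^ q)⁻¹ * (locTest p q τ σ ω ^ q * lpn p (wMeasure σ) f ^ q) := by
  have hp0 : 0 < p := by linarith
  have hq0 : 0 < q := by linarith
  obtain ⟨S, hdisj, hunion, hS⟩ := exists_stopping_cubes F
    (fun j => τ j * lavg j (fun y => f y * σ y)) lam
  set A := {x | lam < ∑ j ∈ F, (dcube j).indicator
        (fun _ => τ j * lavg j (fun y => f y * σ y)) x} with hA
  set B := {x | 2 * lam < ∑ j ∈ F, (dcube j).indicator
        (fun _ => τ j * lavg j (fun y => f y * σ y)) x} with hB
  have hBm : MeasurableSet B := measurableSet_lt_sum_indicator F _ _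
  have hBA : B ⊆ A := by
    intro x hx
    simp only [hA, hB, Set.mem_ofPred_eq] at hx ⊢
    exact lt_of_le_of_lt (by rw [two_mul]; exact le_self_add) hx
  have hεq0 : ε ^ q ≠ 0 := by simp [hε0, hεt]
  have hεqt : ε ^ q ≠ ⊤ := ENNReal.rpow_ne_top_of_nonneg hq0.le hεt
  have hcube : ∀ R ∈ S, lam ^ q * wMeasure ω (dcube R ∩ B) ≤
      ε * (lam ^ q * wMeasure ω (dcube R)) + (ε ^ q)⁻¹ * (locTest p q τ σ ω ^ q *
        (∫⁻ x in dcube R, f x ^ p ∂wMeasure σ) ^ (q / p)) := by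
    intro R hR
    rcases le_or_gt (wMeasure ω (dcube R ∩ B)) (ε * wMeasure ω (dcube R)) with h | h
    · refine le_trans ?_ le_self_add
      rw [mul_left_comm]
      gcongr
    · refine le_trans ?_ le_add_self
      have h0 : wMeasure ω (dcube R) ≠ 0 := fun h0 =>
        not_lt_bot (h.trans_le ((measure_mono Set.inter_subset_left).trans h0.le))
      have := local_testing_bound hp hpq τ hσ hf h0 (hω R)
        ((measurableSet_dcube R).inter hBm) (lam := lam)
        (fun x hx => (hS R hR x hx.1 hx.2).le) h.le
      calc lam ^ q * wMeasure ω (dcube R ∩ B) ≤ lam ^ q * wMeasure ω (dcube R) := by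
            gcongr; exact Set.inter_subset_left
        _ = (ε ^ q)⁻¹ * (ε ^ q * (lam ^ q * wMeasure ω (dcube R))) := by
            rw [← mul_assoc, ENNReal.inv_mul_cancel hεq0 hεqt, one_mul]
        _ ≤ _ := by gcongr
  have hsumω : ∑ R ∈ S, wMeasure ω (dcube R) = wMeasure ω A := by
    rw [← hunion, measure_biUnion_finset hdisj fun R _ => measurableSet_dcube R]
  have hsumσ : ∑ R ∈ S, (∫⁻ x in dcube R, f x ^ p ∂wMeasure σ) ^ (q / p) ≤
      lpn p (wMeasure σ) f ^ q := by
    refine (sum_rpow_le_rpow_sum S _ ((one_le_div hp0).2 hpq)).trans ?_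
    rw [lpn, ← ENNReal.rpow_mul, one_div_mul_eq_div]
    refine ENNReal.rpow_le_rpow ?_ (div_nonneg hq0.le hp0.le)
    rw [← lintegral_biUnion_finset hdisj fun R _ => measurableSet_dcube R]
    exact setLIntegral_le_lintegral _ _
  calc lam ^ q * wMeasure ω B ≤ lam ^ q * ∑ R ∈ S, wMeasure ω (dcube R ∩ B) := by
        gcongr
        refine (measure_mono fun x hx => ?_).trans (measure_biUnion_finset_le S _)
        have hx' := hBA hx
        rw [← hunion] at hx'
        simp only [Set.mem_iUnion, exists_prop] at hx' ⊢
        obtain ⟨R, hR, hxR⟩ := hx'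
        exact ⟨R, hR, hxR, hx⟩
    _ = ∑ R ∈ S, lam ^ q * wMeasure ω (dcube R ∩ B) := Finset.mul_sum _ _ _
    _ ≤ ∑ R ∈ S, (ε * (lam ^ q * wMeasure ω (dcube R)) + (ε ^ q)⁻¹ * (locTest p q τ σ ω ^ q *
        (∫⁻ x in dcube R, f x ^ p ∂wMeasure σ) ^ (q / p))) := Finset.sum_le_sum hcube
    _ = ε * (lam ^ q * wMeasure ω A) + (ε ^ q)⁻¹ * (locTest p q τ σ ω ^ q *
        ∑ R ∈ S, (∫⁻ x in dcube R, f x ^ p ∂wMeasure σ) ^ (q / p)) := by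
        rw [Finset.sum_add_distrib, ← hsumω]
        simp only [Finset.mul_sum]
    _ ≤ _ := by gcongr

/-- Absorption argument: a bounded function satisfying a good-`λ` inequality decays. -/
theorem rpow_mul_le_of_good_lambda {q : ℝ} (hq : 0 < q) {N : ℝ≥0∞ → ℝ≥0∞} {B K : ℝ≥0∞}
    (hB : B ≠ ⊤) (hN : ∀ lam, N lam ≤ B)
    (h : ∀ lam, lam ^ q * N (2 * lam) ≤ (2 ^ (q + 1))⁻¹ * (lam ^ q * N lam) + K)
    {lam : ℝ≥0∞} (hlam : lam ≠ ⊤) : lam ^ q * N lam ≤ 2 * (2 ^ q * K) := by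
  set M := ⨆ (l : ℝ≥0∞) (_ : l ≤ lam), l ^ q * N l with hM
  have hMt : M ≠ ⊤ := by
    refine ne_top_of_le_ne_top (ENNReal.mul_ne_top
      (ENNReal.rpow_ne_top_of_nonneg hq.le hlam) hB) (iSup₂_le fun l hl => ?_)
    exact mul_le_mul' (ENNReal.rpow_le_rpow hl hq.le) (hN l)
  have h2 : (2 : ℝ≥0∞) ^ q * (2 ^ (q + 1))⁻¹ = 2⁻¹ := by
    rw [← ENNReal.rpow_neg, ← ENNReal.rpow_add _ _ two_ne_zero ENNReal.ofNat_ne_top,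
      show q + -(q + 1) = -1 by ring, ENNReal.rpow_neg_one]
  have hle : M ≤ 2⁻¹ * M + 2 ^ q * K := by
    refine iSup₂_le fun l hl => ?_
    have hl2 : 2 * (l / 2) = l := ENNReal.mul_div_cancel two_ne_zero ENNReal.ofNat_ne_top
    have hhalf : (l / 2) ^ q * N (l / 2) ≤ M :=
      le_iSup₂ (f := fun (l : ℝ≥0∞) (_ : l ≤ lam) => l ^ q * N l) (l / 2)
        (ENNReal.half_le_self.trans hl)
    calc l ^ q * N l = 2 ^ q * ((l / 2) ^ q * N (2 * (l / 2))) := by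
          rw [hl2, ← mul_assoc, ← ENNReal.mul_rpow_of_nonneg _ _ hq.le, hl2]
      _ ≤ 2 ^ q * ((2 ^ (q + 1))⁻¹ * ((l / 2) ^ q * N (l / 2)) + K) := by gcongr; exact h _
      _ = 2⁻¹ * ((l / 2) ^ q * N (l / 2)) + 2 ^ q * K := by
          rw [mul_add, ← mul_assoc, h2]
      _ ≤ _ := by gcongr
  have hfin : M ≤ 2 * (2 ^ q * K) := by
    have hs : M = 2⁻¹ * M + 2⁻¹ * M := by
      rw [← add_mul, ENNReal.inv_two_add_inv_two, one_mul]
    have h3 : 2⁻¹ * M ≤ 2 ^ q * K := by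
      have hMt' : 2⁻¹ * M ≠ ⊤ := ENNReal.mul_ne_top (by simp) hMt
      refine (ENNReal.add_le_add_iff_left hMt').1 ?_
      rw [← hs]
      exact hle
    calc M = 2 * (2⁻¹ * M) := by
          rw [← mul_assoc, ENNReal.mul_inv_cancel two_ne_zero ENNReal.ofNat_ne_top, one_mul]
      _ ≤ _ := by gcongr
  exact (le_iSup₂ (f := fun (l : ℝ≥0∞) (_ : l ≤ lam) => l ^ q * N l) lam le_rfl).trans hfin

/-- **Sufficiency of local testing for the weak-type bound.** -/
theorem stmt10 (d : ℕ) (p q : ℝ) (hp : 1 < p) (hpq : p ≤ q) :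
    ∃ C : ℝ≥0∞, 0 < C ∧ C < ⊤ ∧
      ∀ (τ : DIdx d → ℝ≥0∞) (σ ω : (Fin d → ℝ) → ℝ≥0∞),
        Measurable σ → Measurable ω →
        (∀ i : DIdx d, wMeasure σ (dcube i) ≠ ⊤) →
        (∀ i : DIdx d, wMeasure ω (dcube i) ≠ ⊤) →
        locTest p q τ σ ω ≠ ⊤ →
        ∀ f : (Fin d → ℝ) → ℝ≥0∞, Measurable f → lpn p (wMeasure σ) f ≠ ⊤ →
          ∀ lam : ℝ≥0∞, 0 < lam →
            lam ^ q * wMeasure ω {x | lam < Tdy τ (fun y => f y * σ y) x} ≤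
              C * locTest p q τ σ ω ^ q * lpn p (wMeasure σ) f ^ q := by
  have hq0 : 0 < q := by linarith
  set ε : ℝ≥0∞ := (2 ^ (q + 1))⁻¹ with hε
  have hεt : ε ≠ ⊤ := by simp [hε]
  have hε0 : ε ≠ 0 := by
    simp [hε, ENNReal.rpow_ne_top_of_nonneg (by linarith : (0 : ℝ) ≤ q + 1)
      ENNReal.ofNat_ne_top]
  have hεq0 : ε ^ q ≠ 0 := by simp [hε0, hεt]
  have hεqt : ε ^ q ≠ ⊤ := ENNReal.rpow_ne_top_of_nonneg hq0.le hεt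
  have h2q : (2 : ℝ≥0∞) ^ q ≠ ⊤ := ENNReal.rpow_ne_top_of_nonneg hq0.le ENNReal.ofNat_ne_top
  refine ⟨2 * (2 ^ q * (ε ^ q)⁻¹), ?_, ?_, ?_⟩
  · have : (2 : ℝ≥0∞) ^ q ≠ 0 := by simp
    exact pos_iff_ne_zero.2 (mul_ne_zero two_ne_zero (mul_ne_zero this (ENNReal.inv_ne_zero.2 hεqt)))
  · exact (ENNReal.mul_ne_top ENNReal.ofNat_ne_top
      (ENNReal.mul_ne_top h2q (ENNReal.inv_ne_top.2 hεq0))).lt_top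
  intro τ σ ω hσ hω _ hωfin _ f hf _ lam hlam
  rcases eq_or_ne lam ⊤ with rfl | hlamt
  · simp
  set a : DIdx d → ℝ≥0∞ := fun j => τ j * lavg j (fun y => f y * σ y) with ha
  have hset : {x | lam < Tdy τ (fun y => f y * σ y) x} =
      ⋃ F : Finset (DIdx d), {x | lam < ∑ j ∈ F, (dcube j).indicator (fun _ => a j) x} := by
    ext x
    simp only [Set.mem_ofPred_eq, Set.mem_iUnion, Tdy, ENNReal.tsum_eq_iSup_sum, lt_iSup_iff, ha]
  have hdir : Directed (· ⊆ ·) fun F : Finset (DIdx d) =>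
      {x | lam < ∑ j ∈ F, (dcube j).indicator (fun _ => a j) x} :=
    Monotone.directed_le fun F G hFG x hx => by
      simp only [Set.mem_ofPred_eq] at hx ⊢
      exact hx.trans_le (Finset.sum_le_sum_of_subset hFG)
  rw [hset, hdir.measure_iUnion, ENNReal.mul_iSup]
  refine iSup_le fun F => ?_
  have hB : wMeasure ω (⋃ i ∈ F, dcube i) ≠ ⊤ :=
    ((measure_biUnion_finset_le F _).trans_lt
      (ENNReal.sum_lt_top.2 fun i _ => (hωfin i).lt_top)).ne
  have := rpow_mul_le_of_good_lambda hq0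
    (N := fun l => wMeasure ω {x | l < ∑ j ∈ F, (dcube j).indicator (fun _ => a j) x})
    (K := (ε ^ q)⁻¹ * (locTest p q τ σ ω ^ q * lpn p (wMeasure σ) f ^ q)) hB
    (fun l => measure_mono fun x hx => by
      by_contra hcon
      simp only [Set.mem_iUnion, exists_prop, not_exists, not_and] at hcon
      simp only [Set.mem_ofPred_eq] at hx
      rw [Finset.sum_eq_zero fun j hj => Set.indicator_of_notMem (hcon j hj) _] at hx
      exact not_lt_bot hx)
    (fun l => good_lambda hp hpq τ hσ hf hωfin F l hε0 hεt) hlamt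
  refine this.trans (le_of_eq ?_)
  ring
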